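/- Let d, a, b, c, e, b', c' be complex numbers with a' = d-a and e' = d+e-a-b-c, and suppose Re(d+e-a-b-c) > 0, Re(d+e'-a'-b'-c') > 0, and Re(a') > 0 (and no denominator parameter is a nonpositive integer). Then the Kampé de Fériet series F(1,1) = Σ_{m,n≥0} (a)_m(b)_m(c)_m (a')_n(b')_n(c')_n / ((d)_{m+n} (e)_m (e')_n m! n!) equals Γ(d)Γ(e')Γ(d+e'-a'-b'-c') / (Γ(a')Γ(d+e'-a'-b')Γ(d+e'-a'-c')) times ₄F₃[a, e-b, e-c, d+e'-a'-b'-c'; e, d+e'-a'-b', d+e'-a'-c'; 1]. -/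

import Mathlib

open Complex Finset

/-- Pochhammer symbol `(a)_k = a(a+1)⋯(a+k-1)`. -/
noncomputable def poch (a : ℂ) (k : ℕ) : ℂ := ∏ i ∈ Finset.range k, (a + i)

/-- `z` is not a nonpositive integer. -/
def notNonposInt (z : ℂ) : Prop := ∀ k : ℕ, z ≠ -(k : ℂ)

open Filter Topology

/-- reciprocal Gamma -/
noncomputable def rG (z : ℂ) : ℂ := (Complex.Gamma z)⁻¹

lemma rG_rec (z : ℂ) : rG z = z * rG (z + 1) :=
  Complex.one_div_Gamma_eq_self_mul_one_div_Gamma_add_one z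

lemma poch_zero (a : ℂ) : poch a 0 = 1 := by simp [poch]

lemma poch_succ (a : ℂ) (n : ℕ) : poch a (n + 1) = poch a n * (a + n) := by
  simp [poch, Finset.prod_range_succ]

lemma poch_mul_rG (a : ℂ) (n : ℕ) : poch a n * rG (a + n) = rG a := by
  induction n with
  | zero => simp [poch]
  | succ n ih =>
    rw [poch_succ, ← ih, rG_rec (a + n)]
    push_cast
    rw [add_assoc a (n : ℂ) 1]
    ring

lemma Gamma_mul_rG {z : ℂ} (hz : notNonposInt z) : Complex.Gamma z * rG z = 1 :=
  mul_inv_cancel₀ (Complex.Gamma_ne_zero hz)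

lemma nn_of_re_pos {z : ℂ} (hz : 0 < z.re) : notNonposInt z := by
  intro k hk
  rw [hk] at hz
  simp at hz
  have : (0 : ℝ) ≤ k := Nat.cast_nonneg k
  linarith

lemma nn_add {z : ℂ} (hz : notNonposInt z) (n : ℕ) : notNonposInt (z + n) := by
  intro k hk
  apply hz (k + n)
  push_cast
  linear_combination hk

lemma Gamma_add_nat {z : ℂ} (hz : notNonposInt z) (n : ℕ) :
    Complex.Gamma (z + n) = Complex.Gamma z * poch z n := by
  have h1 := Gamma_mul_rG (nn_add hz n)
  have h2 := Gamma_mul_rG hz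
  have h3 := poch_mul_rG z n
  have : Complex.Gamma (z + n) * (Complex.Gamma z * rG z) =
    Complex.Gamma z * poch z n * (Complex.Gamma (z + n) * rG (z + n)) := by
    rw [← h3]; ring
  rw [h1, h2] at this
  simpa using this

lemma poch_inv {z : ℂ} (hz : notNonposInt z) (n : ℕ) :
    (poch z n)⁻¹ = Complex.Gamma z * rG (z + n) := by
  have h2 := Gamma_mul_rG hz
  rw [← poch_mul_rG z n] at h2
  have : poch z n ≠ 0 := by
    intro h0
    rw [h0] at h2
    simp at h2
  field_simp
  linear_combination -h2

lemma poch_add (a : ℂ) (m n : ℕ) : poch a (m + n) = poch a m * poch (a + m) n := by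
  induction n with
  | zero => simp [poch]
  | succ n ih =>
    rw [← add_assoc, poch_succ, ih, poch_succ]
    push_cast
    ring

lemma lim_aux (y : ℂ) : Tendsto (fun N : ℕ => (y + N) / ((N : ℂ) + 1)) atTop (𝓝 1) := by
  have h : Tendsto (fun N : ℕ => 1 + (y - 1) * (1 / ((N : ℂ) + 1))) atTop (𝓝 (1 + (y - 1) * 0)) :=
    tendsto_const_nhds.add (tendsto_const_nhds.mul tendsto_one_div_add_atTop_nhds_zero_nat)
  simp only [mul_zero, add_zero] at h
  refine h.congr fun N => ?_
  have : (N : ℂ) + 1 ≠ 0 := by exact_mod_cast Nat.succ_ne_zero N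
  field_simp
  ring

lemma rG_tendsto (y : ℂ) :
    Tendsto (fun N : ℕ => rG (y + N) * (N.factorial : ℂ) * ((N : ℂ) + 1) ^ (y - 1)) atTop (𝓝 1) := by
  have hN : ∀ N : ℕ, (N : ℂ) + 1 ≠ 0 := fun N => by exact_mod_cast Nat.succ_ne_zero N
  have base : ∀ y : ℂ, 0 < y.re → Tendsto
      (fun N : ℕ => rG (y + N) * (N.factorial : ℂ) * ((N : ℂ) + 1) ^ (y - 1)) atTop (𝓝 1) := by
    intro y hy
    have hG := ((Complex.GammaSeq_tendsto_Gamma y).comp (tendsto_add_atTop_nat 1)).const_mul (rG y)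
    rw [mul_comm (rG y), Gamma_mul_rG (nn_of_re_pos hy)] at hG
    have h2 := ((lim_aux y).mul (lim_aux (y + 1))).mul hG
    simp only [mul_one] at h2
    refine h2.congr fun N => ?_
    have hp : poch y (N + 1 + 1) ≠ 0 := by
      intro h0
      have := poch_mul_rG y (N + 1 + 1)
      rw [h0, zero_mul] at this
      have h4 := Gamma_mul_rG (nn_of_re_pos hy)
      rw [← this] at h4
      simp at h4
    have h5 := poch_mul_rG y (N + 1 + 1)
    have h6 := rG_rec (y + N)
    have h7 := rG_rec (y + N + 1)
    simp only [Function.comp, Complex.GammaSeq]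
    change _ * (rG y * (_ / poch y (N + 1 + 1))) = _
    rw [Complex.cpow_sub _ _ (by simpa using hN N), Complex.cpow_one, Nat.factorial_succ]
    rw [← h5, h6, h7]
    push_cast
    rw [show y + ((N : ℂ) + 1 + 1) = y + N + 1 + 1 by ring]
    have := hN N
    field_simp
    try ring
  have step : ∀ y : ℂ, Tendsto
      (fun N : ℕ => rG (y + 1 + N) * (N.factorial : ℂ) * ((N : ℂ) + 1) ^ (y + 1 - 1)) atTop (𝓝 1) →
      Tendsto (fun N : ℕ => rG (y + N) * (N.factorial : ℂ) * ((N : ℂ) + 1) ^ (y - 1))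
        atTop (𝓝 1) := by
    intro y h
    have h2 := (lim_aux y).mul h
    simp only [mul_one] at h2
    refine h2.congr fun N => ?_
    rw [show y + 1 - 1 = y by ring, rG_rec (y + N),
      Complex.cpow_sub _ _ (by simpa using hN N), Complex.cpow_one, show y + 1 + N = y + N + 1 by ring]
    have := hN N
    field_simp
  have all : ∀ M : ℕ, ∀ y : ℂ, 0 < (y + M).re → Tendsto
      (fun N : ℕ => rG (y + N) * (N.factorial : ℂ) * ((N : ℂ) + 1) ^ (y - 1)) atTop (𝓝 1) := by
    intro M
    induction M with
    | zero => intro y hy; exact base y (by simpa using hy)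
    | succ M ih =>
      intro y hy
      apply step
      apply ih
      push_cast at hy
      rwa [show y + 1 + (M : ℂ) = y + (M + 1) by ring]
  obtain ⟨M, hM⟩ := exists_nat_gt (-y.re)
  exact all M y (by simp; linarith)

/-- growth predicate -/
def Gr (P : ℕ → ℂ) (k : ℤ) (p : ℝ) : Prop :=
  ∃ C : ℝ, 0 ≤ C ∧ ∀ n : ℕ, ‖P n‖ ≤ C * ((n.factorial : ℝ) ^ k * ((n : ℝ) + 1) ^ p)

lemma Gr.mul {P Q : ℕ → ℂ} {k l : ℤ} {p q : ℝ} (hP : Gr P k p) (hQ : Gr Q l q) :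
    Gr (fun n => P n * Q n) (k + l) (p + q) := by
  obtain ⟨C, hC, h⟩ := hP
  obtain ⟨D, hD, h'⟩ := hQ
  refine ⟨C * D, by positivity, fun n => ?_⟩
  have hf : (n.factorial : ℝ) ≠ 0 := by positivity
  rw [norm_mul, zpow_add₀ hf, Real.rpow_add (by positivity)]
  calc _ ≤ _ := mul_le_mul (h n) (h' n) (norm_nonneg _) (by positivity)
    _ = _ := by ring

lemma norm_cpow_nat (n : ℕ) (y : ℂ) : ‖((n : ℂ) + 1) ^ y‖ = ((n : ℝ) + 1) ^ y.re := by
  have := Complex.norm_cpow_eq_rpow_re_of_pos (x := (n : ℝ) + 1) (by positivity) y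
  push_cast at this
  exact this

lemma bdd_of_tendsto {u : ℕ → ℂ} {l : ℂ} (h : Tendsto u atTop (𝓝 l)) :
    ∃ C : ℝ, 0 ≤ C ∧ ∀ n, ‖u n‖ ≤ C := by
  obtain ⟨C, hC⟩ := (Metric.isBounded_range_of_tendsto u h).exists_norm_le
  exact ⟨C, (norm_nonneg _).trans (hC (u 0) ⟨0, rfl⟩), fun n => hC _ ⟨n, rfl⟩⟩

lemma Gr_rG (x : ℂ) : Gr (fun n => rG (x + n)) (-1) (1 - x.re) := by
  obtain ⟨C, hC, h⟩ := bdd_of_tendsto (rG_tendsto x)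
  refine ⟨C, hC, fun n => ?_⟩
  have := h n
  rw [norm_mul, norm_mul, norm_cpow_nat] at this
  simp only [Complex.norm_natCast, Complex.sub_re, Complex.one_re] at this
  rw [zpow_neg_one, show 1 - x.re = -(x.re - 1) by ring, Real.rpow_neg (by positivity)]
  rw [← mul_inv, ← div_eq_mul_inv, le_div_iff₀ (by positivity)]
  linarith

lemma Gr_poch (a : ℂ) : Gr (poch a) 1 (a.re - 1) := by
  have h1 := rG_tendsto a
  have h2 : Tendsto (fun n : ℕ => poch a n / ((n.factorial : ℂ) * ((n : ℂ) + 1) ^ (a - 1)))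
      atTop (𝓝 (rG a)) := by
    have h3 := (tendsto_const_nhds (x := rG a)).div h1 one_ne_zero
    rw [div_one] at h3
    refine h3.congr' ?_
    filter_upwards [h1.eventually_ne one_ne_zero] with n hn
    have hr : rG (a + n) ≠ 0 := fun h => hn (by simp [h])
    rw [← poch_mul_rG a n]
    simp only [Pi.div_apply]
    rw [mul_assoc (rG (a + n)), mul_comm (poch a n), mul_div_mul_left _ _ hr]
  obtain ⟨C, hC, h⟩ := bdd_of_tendsto h2
  refine ⟨C, hC, fun n => ?_⟩
  have := h n
  rw [norm_div, norm_mul, norm_cpow_nat] at this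
  simp only [Complex.norm_natCast, Complex.sub_re, Complex.one_re] at this
  rw [div_le_iff₀ (by positivity)] at this
  simpa using this

lemma Gr_fac : Gr (fun n => ((n.factorial : ℂ))⁻¹) (-1) 0 := by
  refine ⟨1, zero_le_one, fun n => ?_⟩
  simp

lemma two_pow_le_choose (n k : ℕ) (h : k ≤ n) : 2 ^ k ≤ (n + k).choose k := by
  induction k generalizing n with
  | zero => simp
  | succ k ih =>
    have h1 := ih n (by omega)
    have h2 := Nat.add_one_mul_choose_eq (n + k) k
    have h3 : 2 * (k + 1) ≤ n + k + 1 := by omega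
    have h4 : (2 ^ (k + 1)) * (k + 1) ≤ (n + k + 1).choose (k + 1) * (k + 1) := by
      rw [← h2, pow_succ]
      calc _ = 2 * (k + 1) * 2 ^ k := by ring
        _ ≤ _ := Nat.mul_le_mul h3 h1
    exact Nat.le_of_mul_le_mul_right h4 (by omega)

lemma summable_rp {t : ℝ} (ht : t < -1) : Summable (fun n : ℕ => ((n : ℝ) + 1) ^ t) := by
  have := (Real.summable_one_div_nat_add_rpow 1 (-t)).2 (by linarith)
  refine this.congr fun n => ?_
  rw [abs_of_pos (by positivity), one_div, Real.rpow_neg (by positivity), inv_inv]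

lemma summable_rp_geom (p : ℝ) : Summable (fun n : ℕ => ((n : ℝ) + 1) ^ p * (1 / 2) ^ n) := by
  obtain ⟨K, hK⟩ := exists_nat_gt p
  have h1 : Summable (fun n : ℕ => ((n : ℝ)) ^ K * (1 / 2 : ℝ) ^ n) :=
    summable_pow_mul_geometric_of_norm_lt_one K (by norm_num)
  have h2 := ((summable_nat_add_iff 1).2 h1).mul_left 2
  refine Summable.of_nonneg_of_le (fun n => by positivity) (fun n => ?_) h2
  have : ((n : ℝ) + 1) ^ p ≤ ((n : ℝ) + 1) ^ K := by
    rw [← Real.rpow_natCast]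
    exact Real.rpow_le_rpow_of_exponent_le (by linarith [Nat.cast_nonneg (α := ℝ) n]) hK.le
  push_cast
  rw [pow_succ]
  calc _ ≤ ((n : ℝ) + 1) ^ K * (1 / 2) ^ n := by gcongr
    _ = _ := by ring

lemma rp_cmp (t : ℝ) (n k : ℕ) (h : k ≤ n) :
    ((n + k : ℕ) + 1 : ℝ) ^ t ≤ 2 ^ |t| * ((n : ℝ) + 1) ^ t := by
  have hk : (k : ℝ) ≤ n := by exact_mod_cast h
  have hn : (0 : ℝ) < (n : ℝ) + 1 := by positivity
  have hr : ((n + k : ℕ) + 1 : ℝ) = (((n + k : ℕ) + 1 : ℝ) / (n + 1)) * (n + 1) := by field_simp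
  have h1 : (1 : ℝ) ≤ ((n + k : ℕ) + 1 : ℝ) / (n + 1) := by
    rw [le_div_iff₀ hn]; push_cast; linarith [Nat.cast_nonneg (α := ℝ) k]
  have h2 : ((n + k : ℕ) + 1 : ℝ) / (n + 1) ≤ 2 := by
    rw [div_le_iff₀ hn]; push_cast; linarith
  rw [hr, Real.mul_rpow (by positivity) hn.le]
  gcongr
  calc _ ≤ (((n + k : ℕ) + 1 : ℝ) / (n + 1)) ^ |t| :=
        Real.rpow_le_rpow_of_exponent_le h1 (le_abs_self t)
    _ ≤ _ := Real.rpow_le_rpow (by positivity) h2 (abs_nonneg t)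

lemma half_bound (p q r : ℝ) (n k : ℕ) (h : k ≤ n) :
    ((n.factorial : ℝ) * ((n : ℝ) + 1) ^ p) * ((k.factorial : ℝ) * ((k : ℝ) + 1) ^ q) *
      (((n + k).factorial : ℝ)⁻¹ * ((n + k : ℕ) + 1 : ℝ) ^ r) ≤
    2 ^ |r| * (((n : ℝ) + 1) ^ (p + r) * (((k : ℝ) + 1) ^ q * (1 / 2) ^ k)) := by
  have h1 := rp_cmp r n k h
  have h2 : (2 : ℝ) ^ k ≤ ((n + k).choose k : ℝ) := by exact_mod_cast two_pow_le_choose n k h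
  have h3 : ((n + k).choose k : ℝ) * k.factorial * n.factorial = (n + k).factorial := by
    have := Nat.add_choose_mul_factorial_mul_factorial n k
    rw [mul_right_comm]
    exact_mod_cast this
  have h4 : (n.factorial : ℝ) * k.factorial * ((n + k).factorial : ℝ)⁻¹ ≤ (1 / 2) ^ k := by
    rw [← h3]
    have : (n.factorial : ℝ) ≠ 0 := by positivity
    have : (k.factorial : ℝ) ≠ 0 := by positivity
    have hc : (0 : ℝ) < ((n + k).choose k : ℝ) := lt_of_lt_of_le (by positivity) h2
    calc _ = ((n + k).choose k : ℝ)⁻¹ := by field_simp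
      _ ≤ (2 ^ k)⁻¹ := by gcongr
      _ = _ := by simp
  calc _ = (((n : ℝ) + 1) ^ p * ((k : ℝ) + 1) ^ q) *
        (((n.factorial : ℝ) * k.factorial * ((n + k).factorial : ℝ)⁻¹) *
          ((n + k : ℕ) + 1 : ℝ) ^ r) := by ring
    _ ≤ (((n : ℝ) + 1) ^ p * ((k : ℝ) + 1) ^ q) *
        ((1 / 2) ^ k * (2 ^ |r| * ((n : ℝ) + 1) ^ r)) := by gcongr
    _ = _ := by rw [Real.rpow_add (by positivity)]; ring

lemma summable_double {P Q : ℕ → ℂ} {p q : ℝ} (hP : Gr P 1 p) (hQ : Gr Q 1 q) (x : ℂ)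
    (h1 : p + 2 < x.re) (h2 : q + 2 < x.re) :
    Summable (fun z : ℕ × ℕ => P z.1 * Q z.2 * rG (x + (z.1 + z.2 : ℕ))) := by
  obtain ⟨A, hA, hP⟩ := hP
  obtain ⟨B, hB, hQ⟩ := hQ
  obtain ⟨C, hC, hR⟩ := Gr_rG x
  set r := 1 - x.re with hr
  have s1 := ((summable_rp (t := p + r) (by linarith)).mul_of_nonneg (summable_rp_geom q)
    (fun n => by positivity) (fun n => by positivity)).mul_left (A * B * C * 2 ^ |r|)
  have s2 := ((summable_rp_geom p).mul_of_nonneg (summable_rp (t := q + r) (by linarith))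
    (fun n => by positivity) (fun n => by positivity)).mul_left (A * B * C * 2 ^ |r|)
  refine Summable.of_norm_bounded (s1.add s2) ?_
  rintro ⟨n, k⟩
  have hp := hP n
  have hq := hQ k
  have hr' := hR (n + k)
  simp only [zpow_one, zpow_neg_one] at hp hq hr'
  have key : ‖P n * Q k * rG (x + (n + k : ℕ))‖ ≤ A * B * C *
    (((n.factorial : ℝ) * ((n : ℝ) + 1) ^ p) * ((k.factorial : ℝ) * ((k : ℝ) + 1) ^ q) *
      (((n + k).factorial : ℝ)⁻¹ * ((n + k : ℕ) + 1 : ℝ) ^ r)) := by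
    rw [norm_mul, norm_mul]
    calc _ ≤ (A * ((n.factorial : ℝ) * ((n : ℝ) + 1) ^ p)) *
          (B * ((k.factorial : ℝ) * ((k : ℝ) + 1) ^ q)) *
          (C * (((n + k).factorial : ℝ)⁻¹ * ((n + k : ℕ) + 1 : ℝ) ^ r)) := by gcongr
      _ = _ := by ring
  refine key.trans ?_
  rcases le_total k n with h | h
  · refine le_trans (mul_le_mul_of_nonneg_left (half_bound p q r n k h) (by positivity)) ?_
    rw [← mul_assoc]
    exact le_add_of_nonneg_right (by positivity)
  · have := half_bound q p r k n h
    rw [mul_comm ((k.factorial : ℝ) * _), add_comm k n] at this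
    refine le_trans (mul_le_mul_of_nonneg_left this (by positivity)) ?_
    rw [← mul_assoc]
    rw [mul_comm (((k : ℝ) + 1) ^ (q + r))]
    exact le_add_of_nonneg_left (by positivity)

lemma summable_single {P : ℕ → ℂ} {p : ℝ} (hP : Gr P 0 p) (h1 : p < -1) : Summable P := by
  obtain ⟨A, hA, hP⟩ := hP
  refine Summable.of_norm_bounded ((summable_rp h1).mul_left A) fun n => ?_
  simpa using hP n

lemma Gr.congr {P Q : ℕ → ℂ} {k l : ℤ} {p q : ℝ} (hP : Gr P k p) (h : ∀ n, P n = Q n)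
    (hk : k = l) (hp : p = q) : Gr Q l q := by
  subst hk hp
  have : P = Q := funext h
  rwa [← this]

lemma Gr_bc (b c : ℂ) :
    Gr (fun n => poch b n * poch c n * ((n.factorial : ℂ))⁻¹) 1 ((b + c).re - 2) :=
  (((Gr_poch b).mul (Gr_poch c)).mul Gr_fac).congr (fun _ => rfl) (by norm_num)
    (by simp; ring)

lemma Gr_abc (a b c e : ℂ) :
    Gr (fun n => poch a n * poch b n * poch c n * rG (e + n) * ((n.factorial : ℂ))⁻¹) 1
      ((a + b + c - e).re - 2) :=
  (((((Gr_poch a).mul (Gr_poch b)).mul (Gr_poch c)).mul (Gr_rG e)).mul Gr_fac).congr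
    (fun _ => rfl) (by norm_num) (by simp; ring)

/-- Gauss series term -/
noncomputable def tm (b c x : ℂ) (n : ℕ) : ℂ :=
  poch b n * poch c n * ((n.factorial : ℂ))⁻¹ * rG (x + n)

lemma Gr_tm (b c x : ℂ) : Gr (tm b c x) 0 ((b + c).re - x.re - 1) :=
  ((Gr_bc b c).mul (Gr_rG x)).congr (fun _ => rfl) (by norm_num) (by ring)

lemma summable_tm (b c x : ℂ) (h : 0 < (x - b - c).re) : Summable (tm b c x) := by
  apply summable_single (Gr_tm b c x)
  simp at h ⊢
  linarith

lemma gauss_rec (b c x : ℂ) (h : 0 < (x - b - c).re) :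
    (x - b - c) * ∑' n, tm b c x n = (x - b) * (x - c) * ∑' n, tm b c (x + 1) n := by
  have s1 := summable_tm b c x h
  have s2 := summable_tm b c (x + 1) (by simp at h ⊢; linarith)
  have hv := (s1.hasSum.mul_left (x - b - c)).sub (s2.hasSum.mul_left ((x - b) * (x - c)))
  have tel : ∀ n : ℕ, (x - b - c) * tm b c x n - (x - b) * (x - c) * tm b c (x + 1) n =
      (n : ℂ) * tm b c x n - ((n + 1 : ℕ) : ℂ) * tm b c x (n + 1) := by
    intro n
    have hn : (n : ℂ) + 1 ≠ 0 := by exact_mod_cast Nat.succ_ne_zero n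
    have hf : (n.factorial : ℂ) ≠ 0 := by exact_mod_cast n.factorial_ne_zero
    simp only [tm]
    rw [rG_rec (x + n), poch_succ, poch_succ, Nat.factorial_succ]
    push_cast
    rw [show x + 1 + (n : ℂ) = x + n + 1 by ring, show x + ((n : ℂ) + 1) = x + n + 1 by ring]
    field_simp
    ring
  have hq : Tendsto (fun n : ℕ => (n : ℂ) * tm b c x n) atTop (𝓝 0) := by
    obtain ⟨C, hC, hb⟩ := Gr_tm b c x
    have ht : Tendsto (fun n : ℕ => C * ((n : ℝ) + 1) ^ (-(x - b - c).re)) atTop (𝓝 (C * 0)) := by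
      apply Tendsto.const_mul
      exact (tendsto_rpow_neg_atTop h).comp
        (tendsto_atTop_add_const_right _ _ tendsto_natCast_atTop_atTop)
    rw [mul_zero] at ht
    refine squeeze_zero_norm (fun n => ?_) ht
    have := hb n
    simp only [zpow_zero, one_mul] at this
    rw [norm_mul, Complex.norm_natCast]
    calc _ ≤ ((n : ℝ) + 1) * (C * ((n : ℝ) + 1) ^ ((b + c).re - x.re - 1)) := by
          gcongr; linarith
      _ = C * (((n : ℝ) + 1) ^ (1 : ℝ) * ((n : ℝ) + 1) ^ ((b + c).re - x.re - 1)) := by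
          rw [Real.rpow_one]; ring
      _ = _ := by
          rw [← Real.rpow_add (by positivity)]
          congr 2
          simp; ring
  have h3 := hv.tendsto_sum_nat
  have h4 : Tendsto (fun N : ℕ => ∑ n ∈ Finset.range N,
      ((x - b - c) * tm b c x n - (x - b) * (x - c) * tm b c (x + 1) n)) atTop (𝓝 (-0)) := by
    refine hq.neg.congr fun N => ?_
    rw [Finset.sum_congr rfl (fun n _ => tel n), Finset.sum_range_sub']
    simp
  have := tendsto_nhds_unique h3 h4
  rw [neg_zero] at this
  exact sub_eq_zero.1 this

lemma gauss_iter (b c x : ℂ) (h : 0 < (x - b - c).re) (N : ℕ) :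
    poch (x - b - c) N * ∑' n, tm b c x n =
      poch (x - b) N * poch (x - c) N * ∑' n, tm b c (x + N) n := by
  induction N with
  | zero => simp [poch]
  | succ N ih =>
    have h2 := gauss_rec b c (x + N) (by
      simp at h ⊢
      linarith [Nat.cast_nonneg (α := ℝ) N])
    rw [poch_succ, poch_succ, poch_succ, mul_right_comm, ih]
    push_cast
    rw [← add_assoc]
    linear_combination (poch (x - b) N * poch (x - c) N) * h2

lemma inv_lim (y : ℂ) : Tendsto (fun N : ℕ => (y + N)⁻¹) atTop (𝓝 0) := by
  have h := ((lim_aux y).inv₀ one_ne_zero).mul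
    (tendsto_one_div_add_atTop_nhds_zero_nat (𝕜 := ℂ))
  rw [mul_zero] at h
  refine h.congr fun N => ?_
  have : (N : ℂ) + 1 ≠ 0 := by exact_mod_cast Nat.succ_ne_zero N
  rw [inv_div]
  field_simp

lemma gauss_lim (b c x : ℂ) (h : 0 < (x - b - c).re) :
    Tendsto (fun N : ℕ => ∑' n, poch b n * poch c n * ((n.factorial : ℂ))⁻¹ *
      (poch (x + N) n)⁻¹) atTop (𝓝 1) := by
  obtain ⟨N0, hN0⟩ := exists_nat_gt (-x.re)
  set X : ℂ := ((x.re + N0 : ℝ) : ℂ) with hX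
  have hXre : X.re = x.re + N0 := by rw [hX, Complex.ofReal_re]
  have hX0 : 0 < X.re := by rw [hXre]; linarith
  have hs : Summable (fun n => ‖poch b n * poch c n * ((n.factorial : ℂ))⁻¹ *
      (poch X n)⁻¹‖) := by
    have h5 := (summable_tm b c X (by
      simp only [Complex.sub_re, hXre] at h ⊢
      linarith [Nat.cast_nonneg (α := ℝ) N0])).mul_left (Complex.Gamma X)
    refine (h5.congr fun n => ?_).norm
    rw [poch_inv (nn_of_re_pos hX0), tm]
    ring
  have h1 : (1 : ℂ) = ∑' n : ℕ, poch b n * poch c n * ((n.factorial : ℂ))⁻¹ * 0 ^ n := by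
    rw [tsum_eq_single 0]
    · simp [poch]
    · intro n hn
      simp [hn]
  rw [h1]
  refine tendsto_tsum_of_dominated_convergence hs (fun n => ?_) ?_
  · apply Tendsto.const_mul
    have : Tendsto (fun N : ℕ => ∏ i ∈ Finset.range n, (x + i + N)⁻¹) atTop
        (𝓝 (∏ i ∈ Finset.range n, 0)) :=
      tendsto_finsetProd _ fun i _ => inv_lim (x + i)
    simp only [Finset.prod_const, Finset.card_range] at this
    refine this.congr fun N => ?_
    rw [poch, ← Finset.prod_inv_distrib]
    refine Finset.prod_congr rfl fun i _ => ?_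
    rw [add_right_comm]
  · filter_upwards [eventually_ge_atTop N0] with N hN n
    rw [norm_mul, norm_mul _ ((poch X n)⁻¹), norm_inv, norm_inv]
    have hle : ‖poch X n‖ ≤ ‖poch (x + N) n‖ := by
      rw [poch, poch, norm_prod, norm_prod]
      refine Finset.prod_le_prod (fun _ _ => norm_nonneg _) fun i _ => ?_
      have e1 : ‖X + i‖ = x.re + N0 + i := by
        rw [hX]
        have : ((x.re + N0 : ℝ) : ℂ) + i = ((x.re + N0 + i : ℝ) : ℂ) := by push_cast; ring
        rw [this, Complex.norm_real, Real.norm_of_nonneg]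
        have : (0 : ℝ) ≤ i := Nat.cast_nonneg i
        linarith
      have e2 : (x + N + i).re ≤ ‖x + N + i‖ := Complex.re_le_norm _
      rw [e1]
      refine le_trans ?_ e2
      simp
      exact hN
    have hpos : 0 < ‖poch X n‖ := by
      rw [norm_pos_iff]
      intro h0
      have h2 := poch_mul_rG X n
      have h4 := Gamma_mul_rG (nn_of_re_pos hX0)
      rw [← h2, h0] at h4
      simp at h4
    gcongr

lemma gauss (b c x : ℂ) (h : 0 < (x - b - c).re) :
    ∑' n, tm b c x n = Complex.Gamma (x - b - c) * rG (x - b) * rG (x - c) := by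
  set g := ∑' n, tm b c x n with hg
  have hN : ∀ N : ℕ, (N : ℂ) + 1 ≠ 0 := fun N => by exact_mod_cast Nat.succ_ne_zero N
  have l1 := ((rG_tendsto (x - b)).mul (rG_tendsto (x - c))).const_mul (rG (x - b - c) * g)
  have l2 := (((rG_tendsto (x - b - c)).mul (rG_tendsto x)).mul (gauss_lim b c x h)).const_mul
    (rG (x - b) * rG (x - c))
  simp only [mul_one] at l1 l2
  obtain ⟨N0, hN0⟩ := exists_nat_gt (-x.re)
  have l3 := l2.congr' (f₂ := fun N : ℕ => (rG (x - b - c) * g) *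
      (rG (x - b + N) * (N.factorial : ℂ) * ((N : ℂ) + 1) ^ (x - b - 1) *
      (rG (x - c + N) * (N.factorial : ℂ) * ((N : ℂ) + 1) ^ (x - c - 1)))) (by
    filter_upwards [eventually_ge_atTop N0] with N hNN
    have hpos : 0 < (x + N).re := by
      have : (N0 : ℝ) ≤ N := by exact_mod_cast hNN
      simp
      linarith
    have e1 : rG (x + N) * ∑' n, poch b n * poch c n * ((n.factorial : ℂ))⁻¹ *
      (poch (x + N) n)⁻¹ = ∑' n, tm b c (x + N) n := by
      rw [← tsum_mul_left]
      refine tsum_congr fun n => ?_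
      rw [poch_inv (nn_of_re_pos hpos), tm]
      linear_combination (poch b n * poch c n * ((n.factorial : ℂ))⁻¹ * rG (x + N + n)) *
        Gamma_mul_rG (nn_of_re_pos hpos)
    have e2 := gauss_iter b c x h N
    rw [← e1, ← hg] at e2
    have e3 : ((N : ℂ) + 1) ^ (x - b - c - 1) * ((N : ℂ) + 1) ^ (x - 1) =
        ((N : ℂ) + 1) ^ (x - b - 1) * ((N : ℂ) + 1) ^ (x - c - 1) := by
      rw [← Complex.cpow_add _ _ (hN N), ← Complex.cpow_add _ _ (hN N)]
      congr 1
      ring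
    rw [← poch_mul_rG (x - b) N, ← poch_mul_rG (x - c) N, ← poch_mul_rG (x - b - c) N]
    linear_combination (-(rG (x - b - c + N) * rG (x - b + N) * rG (x - c + N) *
      (N.factorial : ℂ) ^ 2 * ((N : ℂ) + 1) ^ (x - b - 1) * ((N : ℂ) + 1) ^ (x - c - 1))) * e2 +
      (poch (x - b) N * poch (x - c) N * rG (x - b - c + N) * rG (x - b + N) * rG (x - c + N) *
      (N.factorial : ℂ) ^ 2 * (rG (x + N) * ∑' n, poch b n * poch c n * ((n.factorial : ℂ))⁻¹ *
      (poch (x + N) n)⁻¹)) * e3)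
  have e := tendsto_nhds_unique l1 l3
  have hG := Gamma_mul_rG (nn_of_re_pos h)
  linear_combination (Complex.Gamma (x - b - c)) * e - g * hG

lemma swap_sum {P Q : ℕ → ℂ} {p q : ℝ} (hP : Gr P 1 p) (hQ : Gr Q 1 q) (x : ℂ)
    (h1 : p + 2 < x.re) (h2 : q + 2 < x.re) :
    ∑' n : ℕ, P n * ∑' k : ℕ, Q k * rG (x + n + k) =
      ∑' k : ℕ, Q k * ∑' n : ℕ, P n * rG (x + k + n) := by
  have hs := summable_double hP hQ x h1 h2
  have := Summable.tsum_comm (f := fun n k : ℕ => P n * Q k * rG (x + (n + k : ℕ))) hs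
  simp_rw [← tsum_mul_left]
  calc _ = ∑' (n : ℕ) (k : ℕ), P n * Q k * rG (x + (n + k : ℕ)) := by
        refine tsum_congr fun n => tsum_congr fun k => ?_
        push_cast
        rw [← add_assoc, mul_assoc]
    _ = _ := this.symm
    _ = _ := by
        refine tsum_congr fun n => tsum_congr fun k => ?_
        push_cast
        rw [show x + ((k : ℂ) + n) = x + n + k by ring]
        ring

/-- term of the normalised 3F2 series -/
noncomputable def kt (b c e δ a : ℂ) (n : ℕ) : ℂ :=
  poch a n * poch b n * poch c n * rG (e + n) * ((n.factorial : ℂ))⁻¹ * rG (a + δ + n)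

lemma thomae (b c e δ a s : ℂ) (hs : s = δ + e - b - c) (ha : 0 < a.re) (hs0 : 0 < s.re) :
    Complex.Gamma a * ∑' n, kt b c e δ a n = Complex.Gamma s * ∑' k : ℕ,
      poch (e - a) k * poch δ k * ((k.factorial : ℂ))⁻¹ * poch s k *
        rG (s + b + k) * rG (s + c + k) := by
  have key := swap_sum (Gr_bc b c) (Gr_bc (e - a) δ) (δ + e)
    (by rw [hs] at hs0; simp at hs0 ⊢; linarith) (by simp; linarith)
  rw [← tsum_mul_left, ← tsum_mul_left]
  calc _ = _ := ?_
    _ = _ := key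
    _ = _ := ?_
  · refine tsum_congr fun n => ?_
    have hg := gauss (e - a) δ (δ + e + n) (by
      simp; linarith [Nat.cast_nonneg (α := ℝ) n])
    simp only [tm] at hg
    rw [hg, show δ + e + n - (e - a) - δ = a + n by ring,
      show δ + e + n - (e - a) = a + δ + n by ring, show δ + e + n - δ = e + n by ring,
      Gamma_add_nat (nn_of_re_pos ha), kt]
    ring
  · refine tsum_congr fun k => ?_
    have hg := gauss b c (δ + e + k) (by
      rw [hs] at hs0
      simp at hs0 ⊢; linarith [Nat.cast_nonneg (α := ℝ) k])
    simp only [tm] at hg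
    rw [hg, show δ + e + k - b - c = s + k by rw [hs]; ring,
      show δ + e + k - b = s + c + k by rw [hs]; ring,
      show δ + e + k - c = s + b + k by rw [hs]; ring,
      Gamma_add_nat (nn_of_re_pos hs0)]
    ring

lemma kummer_pos (b c e δ a s : ℂ) (hs : s = δ + e - b - c) (ha : 0 < a.re) (hs0 : 0 < s.re)
    (hδ : 0 < δ.re) :
    Complex.Gamma δ * ∑' n, kt b c e δ a n =
      Complex.Gamma s * ∑' n, kt (e - b) (e - c) e s a n := by
  have h1 := thomae b c e δ a s hs ha hs0
  have h2 := thomae (e - b) (e - c) e s a δ (by rw [hs]; ring) ha hδ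
  have h3 : ∑' k : ℕ, poch (e - a) k * poch s k * ((k.factorial : ℂ))⁻¹ * poch δ k *
        rG (δ + (e - b) + k) * rG (δ + (e - c) + k) = ∑' k : ℕ,
      poch (e - a) k * poch δ k * ((k.factorial : ℂ))⁻¹ * poch s k *
        rG (s + b + k) * rG (s + c + k) := by
    refine tsum_congr fun k => ?_
    rw [show δ + (e - b) = s + c by rw [hs]; ring, show δ + (e - c) = s + b by rw [hs]; ring]
    ring
  rw [h3] at h2
  have hG := Complex.Gamma_ne_zero (nn_of_re_pos ha)
  apply mul_left_cancel₀ hG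
  linear_combination (Complex.Gamma δ) * h1 - (Complex.Gamma s) * h2

lemma beta_bound (z δ : ℂ) (t : ℝ) (ht : 0 < t) (hz : t ≤ z.re) (hδ : 0 < δ.re) :
    ‖Complex.betaIntegral z δ‖ ≤ ‖Complex.betaIntegral (t : ℂ) (δ.re : ℂ)‖ := by
  set F : ℝ → ℂ := fun x => (x : ℂ) ^ ((t : ℂ) - 1) * (1 - (x : ℂ)) ^ ((δ.re : ℂ) - 1) with hF
  have hint : IntervalIntegrable F MeasureTheory.volume 0 1 :=
    Complex.betaIntegral_convergent (by simpa using ht) (by simpa using hδ)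
  have hne : ∀ᵐ x : ℝ, x ≠ 1 := MeasureTheory.Measure.ae_ne _ 1
  have hnF : ∀ x : ℝ, 0 < x → x < 1 → ‖F x‖ = x ^ (t - 1) * (1 - x) ^ (δ.re - 1) := by
    intro x h0 h1
    have h2 : (1 - (x : ℂ)) = ((1 - x : ℝ) : ℂ) := by push_cast; ring
    simp only [hF]
    rw [norm_mul, h2, Complex.norm_cpow_eq_rpow_re_of_pos h0,
      Complex.norm_cpow_eq_rpow_re_of_pos (by linarith)]
    simp
  have e1 : Complex.betaIntegral (t : ℂ) (δ.re : ℂ) = ((∫ x in (0 : ℝ)..1, ‖F x‖ : ℝ) : ℂ) := by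
    rw [← intervalIntegral.integral_ofReal]
    refine intervalIntegral.integral_congr_ae ?_
    filter_upwards [hne] with x hx hx2
    rw [Set.uIoc_of_le zero_le_one] at hx2
    have h0 := hx2.1
    have h1 : x < 1 := lt_of_le_of_ne hx2.2 hx
    rw [hnF x h0 h1]
    push_cast
    rw [Complex.ofReal_cpow h0.le, Complex.ofReal_cpow (by linarith)]
    push_cast
    rfl
  rw [e1, Complex.norm_real]
  refine le_trans ?_ (le_abs_self _)
  refine intervalIntegral.norm_integral_le_of_norm_le zero_le_one ?_ hint.norm
  filter_upwards [hne] with x hx hx2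
  have h0 := hx2.1
  have h1 : x < 1 := lt_of_le_of_ne hx2.2 hx
  have h2 : (1 - (x : ℂ)) = ((1 - x : ℝ) : ℂ) := by push_cast; ring
  rw [hnF x h0 h1, norm_mul, h2, Complex.norm_cpow_eq_rpow_re_of_pos h0,
      Complex.norm_cpow_eq_rpow_re_of_pos (by linarith)]
  simp only [Complex.sub_re, Complex.one_re]
  have h3 : 0 < 1 - x := by linarith
  have : x ^ (z.re - 1) ≤ x ^ (t - 1) :=
    Real.rpow_le_rpow_of_exponent_ge h0 h1.le (by linarith)
  gcongr

lemma summable_kt (b c e δ a : ℂ) (hs : 0 < (δ + e - b - c).re) : Summable (kt b c e δ a) := by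
  refine summable_single (((Gr_abc a b c e).mul (Gr_rG (a + δ))).congr (fun _ => rfl)
    (by norm_num) rfl) ?_
  simp at hs ⊢
  linarith

lemma fac_inv (n : ℕ) : ((n.factorial : ℂ))⁻¹ = rG (1 + n) := by
  rw [rG, add_comm, Complex.Gamma_nat_eq_factorial]

lemma differentiable_rG : Differentiable ℂ rG := Complex.differentiable_one_div_Gamma

lemma differentiable_poch (n : ℕ) : Differentiable ℂ (fun a => poch a n) := by
  induction n with
  | zero => simp [poch]
  | succ n ih =>
    simp only [poch_succ]
    fun_prop

lemma differentiable_kt (b c e δ : ℂ) (n : ℕ) : Differentiable ℂ (fun a => kt b c e δ a n) := by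
  have h1 := differentiable_poch n
  have h2 : Differentiable ℂ (fun a => rG (a + δ + n)) :=
    differentiable_rG.comp (by fun_prop)
  simp only [kt]
  fun_prop

lemma differentiable_K (b c e δ : ℂ) (hδ : 0 < δ.re) (hs : 0 < (δ + e - b - c).re) :
    Differentiable ℂ (fun a => ∑' n, kt b c e δ a n) := by
  have main : ∀ R : ℕ, DifferentiableOn ℂ (fun a => ∑' n, kt b c e δ a n) (Metric.ball 0 R) := by
    intro R
    have hsplit : (fun a => ∑' n, kt b c e δ a n) = fun a =>
        (∑ n ∈ Finset.range (R + 1), kt b c e δ a n) + ∑' m, kt b c e δ a (m + (R + 1)) := by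
      funext a
      exact ((summable_kt b c e δ a hs).sum_add_tsum_nat_add (R + 1)).symm
    rw [hsplit]
    refine DifferentiableOn.add ?_ ?_
    · exact DifferentiableOn.fun_sum fun n _ => (differentiable_kt b c e δ n).differentiableOn
    obtain ⟨M, hM⟩ := (isCompact_closedBall (0 : ℂ) R).exists_bound_of_continuousOn
      differentiable_rG.continuous.continuousOn
    set N := R + 1 with hN
    set w : ℕ → ℂ := fun m => poch b (m + N) * poch c (m + N) * rG (e + (m + N : ℕ)) *
      (((m + N).factorial : ℂ))⁻¹ with hw
    set B : ℕ → ℂ := fun m => (m.factorial : ℂ) * rG (1 + δ.re + m) with hB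
    have hGf : Gr (fun m => (m.factorial : ℂ)) 1 0 := ⟨1, zero_le_one, fun n => by simp⟩
    have hGrw : Gr (fun m => w m * B m) 0 (b.re + c.re - e.re - 1 - δ.re) := by
      have h1 := ((Gr_poch (b + N)).mul (Gr_poch (c + N))).mul (Gr_rG (e + N))
      have h2 := h1.mul (Gr_rG (1 + N))
      have h3 := h2.mul (hGf.mul (Gr_rG (1 + δ.re)))
      have hc : Gr (fun n : ℕ => poch b N * poch c N) 0 0 :=
        ⟨‖poch b N * poch c N‖, norm_nonneg _, fun n => by simp⟩
      refine (hc.mul h3).congr (fun m => ?_) (by norm_num) ?_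
      · simp only [hw, hB]
        rw [add_comm m N, poch_add b N m, poch_add c N m, fac_inv]
        push_cast
        rw [add_assoc e, add_assoc 1 (N : ℂ)]
        ring
      · simp
        ring
    have hsum : Summable (fun m => ‖rG δ * Complex.Gamma δ.re‖ * M * ‖w m * B m‖) := by
      refine ((summable_single hGrw ?_).norm).mul_left _
      simp at hs
      linarith
    refine differentiableOn_tsum_of_summable_norm hsum
      (fun m => (differentiable_kt b c e δ _).differentiableOn) Metric.isOpen_ball ?_
    intro m a ha
    have hnorm : ‖a‖ < R := by simpa using ha
    have hre : ((m : ℝ) + 1) ≤ (a + (m + N : ℕ)).re := by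
      have := (abs_le.1 (Complex.abs_re_le_norm a)).1
      rw [hN]
      simp
      linarith
    have hpos : 0 < (a + (m + N : ℕ)).re := lt_of_lt_of_le (by positivity) hre
    have hb := beta_bound (a + (m + N : ℕ)) δ ((m : ℝ) + 1) (by positivity) hre hδ
    have hG1 := Complex.Gamma_mul_Gamma_eq_betaIntegral hpos hδ
    have hG2 := Complex.Gamma_mul_Gamma_eq_betaIntegral (s := ((m + 1 : ℝ) : ℂ)) (t := (δ.re : ℂ))
      (by simp; positivity) (by simpa using hδ)
    have n1 : Complex.Gamma (a + (m + N : ℕ) + δ) * rG (a + (m + N : ℕ) + δ) = 1 :=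
      Gamma_mul_rG (nn_of_re_pos (by rw [Complex.add_re]; linarith))
    have n2 : Complex.Gamma (((m + 1 : ℝ) : ℂ) + δ.re) * rG (((m + 1 : ℝ) : ℂ) + δ.re) = 1 :=
      Gamma_mul_rG (nn_of_re_pos (by simp; positivity))
    have n3 := Gamma_mul_rG (nn_of_re_pos hδ)
    have n4 := Gamma_mul_rG (nn_of_re_pos hpos)
    have n5 := poch_mul_rG a (m + N)
    have eB : Complex.betaIntegral ((m + 1 : ℝ) : ℂ) (δ.re : ℂ) = Complex.Gamma δ.re * B m := by
      simp only [hB]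
      have hf : Complex.Gamma ((m + 1 : ℝ) : ℂ) = (m.factorial : ℂ) := by
        push_cast
        exact Complex.Gamma_nat_eq_factorial m
      rw [hf] at hG2
      rw [show (1 : ℂ) + δ.re + m = ((m + 1 : ℝ) : ℂ) + δ.re by push_cast; ring]
      linear_combination (-Complex.betaIntegral ((m + 1 : ℝ) : ℂ) (δ.re : ℂ)) * n2 -
        (rG (((m + 1 : ℝ) : ℂ) + δ.re)) * hG2
    have eK : kt b c e δ a (m + N) =
        rG δ * rG a * w m * Complex.betaIntegral (a + (m + N : ℕ)) δ := by
      have e1 : poch a (m + N) * rG (a + δ + (m + N : ℕ)) =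
          rG δ * rG a * Complex.betaIntegral (a + (m + N : ℕ)) δ := by
        rw [show a + δ + ((m + N : ℕ) : ℂ) = a + (m + N : ℕ) + δ by ring]
        set z := a + ((m + N : ℕ) : ℂ)
        set β := Complex.betaIntegral z δ
        calc _ = poch a (m + N) * rG (z + δ) * (Complex.Gamma z * rG z) *
              (Complex.Gamma δ * rG δ) := by rw [n3, n4]; ring
          _ = (poch a (m + N) * rG z) * rG δ * rG (z + δ) *
              (Complex.Gamma z * Complex.Gamma δ) := by ring
          _ = rG a * rG δ * β * (Complex.Gamma (z + δ) * rG (z + δ)) := by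
            rw [hG1, n5]; ring
          _ = _ := by rw [n1]; ring
      simp only [kt, hw]
      linear_combination (poch b (m + N) * poch c (m + N) * rG (e + (m + N : ℕ)) *
        (((m + N).factorial : ℂ))⁻¹) * e1
    rw [eK]
    have hra : ‖rG a‖ ≤ M := hM a (by simpa using hnorm.le)
    rw [show (((m : ℝ) + 1 : ℝ) : ℂ) = ((m + 1 : ℝ) : ℂ) from rfl, eB] at hb
    simp only [norm_mul] at hb ⊢
    have hM0 : 0 ≤ M := (norm_nonneg _).trans hra
    calc _ ≤ ‖rG δ‖ * M * ‖w m‖ * (‖Complex.Gamma δ.re‖ * ‖B m‖) := by gcongr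
      _ = _ := by ring
  intro a
  obtain ⟨R, hR⟩ := exists_nat_gt ‖a‖
  exact (main R).differentiableAt (Metric.isOpen_ball.mem_nhds (by simpa using hR))

lemma kummer (b c e δ a s : ℂ) (hs : s = δ + e - b - c) (hs0 : 0 < s.re) (hδ : 0 < δ.re) :
    Complex.Gamma δ * ∑' n, kt b c e δ a n =
      Complex.Gamma s * ∑' n, kt (e - b) (e - c) e s a n := by
  have d1 := (differentiable_K b c e δ hδ (hs ▸ hs0)).const_mul (Complex.Gamma δ)
  have d2 := (differentiable_K (e - b) (e - c) e s hs0
    (by rw [hs]; simp; linarith)).const_mul (Complex.Gamma s)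
  have := AnalyticOnNhd.eq_of_eventuallyEq (𝕜 := ℂ) (z₀ := (1 : ℂ))
    (fun z _ => d1.analyticAt z) (fun z _ => d2.analyticAt z) (by
      have ho : IsOpen {z : ℂ | 0 < z.re} := isOpen_lt continuous_const Complex.continuous_re
      filter_upwards [ho.mem_nhds (show (1 : ℂ) ∈ {z : ℂ | 0 < z.re} by simp)] with z hz
      exact kummer_pos b c e δ z s hs hz hs0 hδ)
  exact congrFun this a

theorem kdf1_transformation (d a b c e a' b' c' e' : ℂ)
    (ha' : a' = d - a) (he' : e' = d + e - a - b - c)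
    (h1 : 0 < (d + e - a - b - c).re) (h2 : 0 < (d + e' - a' - b' - c').re)
    (h3 : 0 < a'.re)
    (hd : notNonposInt d) (he : notNonposInt e) (hee : notNonposInt e')
    (hd1 : notNonposInt (d + e' - a' - b')) (hd2 : notNonposInt (d + e' - a' - c')) :
    (∑' (m : ℕ) (n : ℕ),
        poch a m * poch b m * poch c m * poch a' n * poch b' n * poch c' n /
          (poch d (m + n) * poch e m * poch e' n *
            (Nat.factorial m : ℂ) * (Nat.factorial n : ℂ))) =
      Complex.Gamma d * Complex.Gamma e' * Complex.Gamma (d + e' - a' - b' - c') /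
          (Complex.Gamma a' * Complex.Gamma (d + e' - a' - b') *
            Complex.Gamma (d + e' - a' - c')) *
        ∑' (k : ℕ),
          poch a k * poch (e - b) k * poch (e - c) k * poch (d + e' - a' - b' - c') k /
            (poch e k * poch (d + e' - a' - b') k * poch (d + e' - a' - c') k *
              (Nat.factorial k : ℂ)) := by
  have hd1' : d + e' - a' - b' = a + e' - b' := by rw [ha']; ring
  have hd2' : d + e' - a' - c' = a + e' - c' := by rw [ha']; ring
  have hss : d + e' - a' - b' - c' = a + e' - b' - c' := by rw [ha']; ring
  rw [hss] at h2 ⊢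
  rw [hd1'] at hd1 ⊢
  rw [hd2'] at hd2 ⊢
  have he'0 : 0 < e'.re := by rw [he']; exact h1
  have hda : a + a' = d := by rw [ha']; ring
  have gr1 := Gr_abc a b c e
  have gr2 := Gr_abc a' b' c' e'
  have gr3 := Gr_abc a (e - b) (e - c) e
  have gr4 := Gr_bc b' c'
  have sw1 := swap_sum gr1 gr2 d
    (by simp at h1 ⊢; linarith)
    (by rw [← hda]; simp at h2 ⊢; linarith)
  have sw2 := swap_sum gr4 gr3 (a + e')
    (by simp at h2 ⊢; linarith)
    (by rw [he', ← hda]; simp at h3 ⊢; linarith)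
  have L : (∑' (m : ℕ) (n : ℕ),
        poch a m * poch b m * poch c m * poch a' n * poch b' n * poch c' n /
          (poch d (m + n) * poch e m * poch e' n *
            (Nat.factorial m : ℂ) * (Nat.factorial n : ℂ))) =
      Complex.Gamma d * Complex.Gamma e * Complex.Gamma e' * ∑' m : ℕ,
        poch a m * poch b m * poch c m * rG (e + m) * ((m.factorial : ℂ))⁻¹ * ∑' n : ℕ,
        poch a' n * poch b' n * poch c' n * rG (e' + n) * ((n.factorial : ℂ))⁻¹ *
          rG (d + m + n) := by
    simp_rw [← tsum_mul_left]
    refine tsum_congr fun m => tsum_congr fun n => ?_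
    rw [div_eq_mul_inv]
    simp only [mul_inv]
    rw [poch_inv hd, poch_inv he, poch_inv hee]
    push_cast
    rw [← add_assoc]
    ring
  have K : ∀ n : ℕ, poch a' n * poch b' n * poch c' n * rG (e' + n) * ((n.factorial : ℂ))⁻¹ *
      ∑' m : ℕ, poch a m * poch b m * poch c m * rG (e + m) * ((m.factorial : ℂ))⁻¹ *
        rG (d + n + m) = rG a' * (poch b' n * poch c' n * ((n.factorial : ℂ))⁻¹ * ∑' k : ℕ,
        poch a k * poch (e - b) k * poch (e - c) k * rG (e + k) * ((k.factorial : ℂ))⁻¹ *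
        rG (a + e' + n + k)) := by
    intro n
    have hn : (0 : ℝ) ≤ n := Nat.cast_nonneg n
    have hp1 : 0 < (a' + n).re := by simp; linarith
    have hp2 : 0 < (e' + n).re := by simp; linarith
    have hk := kummer b c e (a' + n) a (e' + n) (by rw [he', ha']; ring) hp2 hp1
    simp only [kt] at hk
    rw [← add_assoc a a', ← add_assoc a e', hda] at hk
    set X := ∑' m : ℕ, poch a m * poch b m * poch c m * rG (e + m) * ((m.factorial : ℂ))⁻¹ *
        rG (d + n + m)
    set Y := ∑' k : ℕ, poch a k * poch (e - b) k * poch (e - c) k * rG (e + k) *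
      ((k.factorial : ℂ))⁻¹ * rG (a + e' + n + k)
    have g1 := Gamma_mul_rG (nn_of_re_pos hp1)
    have g2 := Gamma_mul_rG (nn_of_re_pos hp2)
    have g3 := poch_mul_rG a' n
    have hX : X * rG (e' + n) = rG (a' + n) * Y := by
      linear_combination (-(X * rG (e' + n))) * g1 + (rG (a' + n) * Y) * g2 +
        (rG (a' + n) * rG (e' + n)) * hk
    rw [← g3]
    linear_combination (poch a' n * poch b' n * poch c' n * ((n.factorial : ℂ))⁻¹) * hX
  have G : ∀ k : ℕ, ∑' n : ℕ, poch b' n * poch c' n * ((n.factorial : ℂ))⁻¹ *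
      rG (a + e' + k + n) = Complex.Gamma (a + e' - b' - c') * poch (a + e' - b' - c') k *
        rG (a + e' - b' + k) * rG (a + e' - c' + k) := by
    intro k
    have hg := gauss b' c' (a + e' + k) (by
      simp at h2 ⊢; linarith [Nat.cast_nonneg (α := ℝ) k])
    simp only [tm] at hg
    rw [hg, show a + e' + k - b' - c' = a + e' - b' - c' + k by ring,
      show a + e' + k - b' = a + e' - b' + k by ring,
      show a + e' + k - c' = a + e' - c' + k by ring, Gamma_add_nat (nn_of_re_pos h2)]
  rw [L, sw1, tsum_congr K, tsum_mul_left, sw2]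
  simp_rw [G]
  simp_rw [← tsum_mul_left]
  refine tsum_congr fun k => ?_
  simp only [div_eq_mul_inv, mul_inv]
  rw [poch_inv he, poch_inv hd1, poch_inv hd2]
  have g1 := Gamma_mul_rG hd1
  have g2 := Gamma_mul_rG hd2
  have e1 : (Complex.Gamma a')⁻¹ = rG a' := rfl
  have e2 : (Complex.Gamma (a + e' - b'))⁻¹ = rG (a + e' - b') := rfl
  have e3 : (Complex.Gamma (a + e' - c'))⁻¹ = rG (a + e' - c') := rfl
  rw [e1, e2, e3]
  set U := Complex.Gamma d * Complex.Gamma e * Complex.Gamma e' * rG a' *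
    (poch a k * poch (e - b) k * poch (e - c) k * rG (e + k) * ((k.factorial : ℂ))⁻¹) *
    (Complex.Gamma (a + e' - b' - c') * poch (a + e' - b' - c') k *
        rG (a + e' - b' + k) * rG (a + e' - c' + k)) with hU
  calc _ = U * 1 * 1 := by rw [hU]; ring
    _ = U * (Complex.Gamma (a + e' - b') * rG (a + e' - b')) *
        (Complex.Gamma (a + e' - c') * rG (a + e' - c')) := by rw [g1, g2]
    _ = _ := by rw [hU]; ring
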